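/- For every θ ≥ 0, every measurable essentially bounded function u on [0,θ], and all finite lists M, N of nonnegative integers, the product of the corresponding nonlinear power moments equals the sum of the moments over all shuffles of M and N: ξ_M(θ,u)·ξ_N(θ,u) = Σ_{W ∈ Sh(M,N)} ξ_W(θ,u), where the sum is taken with multiplicity over the shuffle multiset Sh(M,N). In particular, ξ_{m}(θ,u)·ξ_{n}(θ,u) = ξ_{mn}(θ,u) + ξ_{nm}(θ,u). -/

import Mathlib

open MeasureTheory

/-- Nonlinear power moments: `xi [] θ u = 1` and
`xi (m :: M) θ u = ∫_0^θ τ^m u(τ) xi M τ u dτ`. -/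
noncomputable def xi : List ℕ → ℝ → (ℝ → ℝ) → ℝ
  | [], _, _ => 1
  | m :: M, θ, u => ∫ τ in (0:ℝ)..θ, τ ^ m * u τ * xi M τ u

/-- The shuffle multiset of two lists. -/
def shuffles : List ℕ → List ℕ → Multiset (List ℕ)
  | [], N => {N}
  | M, [] => {M}
  | m :: M, n :: N =>
      ((shuffles M (n :: N)).map (fun W => m :: W)) +
      ((shuffles (m :: M) N).map (fun W => n :: W))
  termination_by M N => M.length + N.length

/-- Integration by parts for primitives of interval integrable functions. -/
theorem primitive_mul_primitive {f g : ℝ → ℝ} {a b : ℝ}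
    (hf : IntervalIntegrable f volume a b) (hg : IntervalIntegrable g volume a b) :
    (∫ x in a..b, f x) * (∫ x in a..b, g x) =
      (∫ x in a..b, f x * ∫ y in a..x, g y) + ∫ x in a..b, g x * ∫ y in a..x, f y := by
  have hF := hf.absolutelyContinuousOnInterval_intervalIntegral (c := a) (by simp)
  have hG := hg.absolutelyContinuousOnInterval_intervalIntegral (c := a) (by simp)
  have key := hF.integral_deriv_mul_eq_sub hG
  simp only [intervalIntegral.integral_same, zero_mul, sub_zero] at key
  rw [← key, ← intervalIntegral.integral_add (hf.mul_continuousOn hG.continuousOn)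
    (hg.mul_continuousOn hF.continuousOn)]
  apply intervalIntegral.integral_congr_ae
  filter_upwards [hf.ae_hasDerivAt_integral, hg.ae_hasDerivAt_integral] with x hx₁ hx₂ hx
  have hx' := Set.uIoc_subset_uIcc hx
  rw [(hx₁ hx' a (by simp)).deriv, (hx₂ hx' a (by simp)).deriv]
  ring

section

variable {u : ℝ → ℝ} {θ : ℝ}

theorem continuousOn_xi (hu : IntervalIntegrable u volume 0 θ) (M : List ℕ) :
    ContinuousOn (fun t => xi M t u) (Set.uIcc 0 θ) := by
  induction M with
  | nil => simpa only [xi] using continuousOn_const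
  | cons m M ih =>
    simp only [xi]
    exact intervalIntegral.continuousOn_primitive_interval'
      ((hu.continuousOn_mul (by fun_prop)).mul_continuousOn ih) (by simp)

theorem intervalIntegrable_xi_integrand (hu : IntervalIntegrable u volume 0 θ) (m : ℕ)
    (M : List ℕ) : IntervalIntegrable (fun τ => τ ^ m * u τ * xi M τ u) volume 0 θ :=
  (hu.continuousOn_mul (by fun_prop)).mul_continuousOn (continuousOn_xi hu M)

theorem integral_mul_sum_xi (hu : IntervalIntegrable u volume 0 θ) (m : ℕ)
    (S : Multiset (List ℕ)) :
    IntervalIntegrable (fun τ => τ ^ m * u τ * (S.map fun W => xi W τ u).sum) volume 0 θ ∧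
      ∫ τ in (0 : ℝ)..θ, τ ^ m * u τ * (S.map fun W => xi W τ u).sum =
        (S.map fun W => xi (m :: W) θ u).sum := by
  induction S using Multiset.induction_on with
  | empty => simp
  | cons W S ih =>
    have hW := intervalIntegrable_xi_integrand hu m W
    simp only [Multiset.map_cons, Multiset.sum_cons, mul_add]
    exact ⟨hW.add ih.1, by rw [intervalIntegral.integral_add hW ih.1, ih.2]; simp only [xi]⟩

theorem xi_mul_xi (M N : List ℕ) (hu : IntervalIntegrable u volume 0 θ) :
    xi M θ u * xi N θ u = ((shuffles M N).map fun W => xi W θ u).sum := by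
  induction M generalizing N θ with
  | nil => simp [xi, shuffles]
  | cons m M ihM =>
    induction N generalizing θ with
    | nil => simp [xi, shuffles]
    | cons n N ihN =>
      rw [shuffles, Multiset.map_add, Multiset.sum_add, Multiset.map_map, Multiset.map_map]
      simp only [Function.comp_def]
      rw [← (integral_mul_sum_xi hu m _).2, ← (integral_mul_sum_xi hu n _).2]
      have hsub {τ : ℝ} (hτ : τ ∈ Set.uIcc 0 θ) : IntervalIntegrable u volume 0 τ :=
        hu.mono_set (Set.uIcc_subset_uIcc_left hτ)
      refine (primitive_mul_primitive (intervalIntegrable_xi_integrand hu m M)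
        (intervalIntegrable_xi_integrand hu n N)).trans (congrArg₂ _ ?_ ?_)
      · refine intervalIntegral.integral_congr fun τ hτ => ?_
        simp only [← ihM (n :: N) (hsub hτ), xi]
        ring
      · refine intervalIntegral.integral_congr fun τ hτ => ?_
        simp only [← ihN (hsub hτ), xi]
        ring

end

/-- The product of two nonlinear power moments equals the sum of the moments over
all shuffles of the index lists; in particular
`ξ_m·ξ_n = ξ_{mn} + ξ_{nm}`. -/
theorem xi_mul_eq_sum_shuffles (θ : ℝ) (hθ : 0 ≤ θ) (u : ℝ → ℝ) (hu : Measurable u)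
    (hbd : ∃ C : ℝ, ∀ᵐ t ∂(volume.restrict (Set.Icc (0:ℝ) θ)), |u t| ≤ C)
    (M N : List ℕ) :
    xi M θ u * xi N θ u = ((shuffles M N).map (fun W => xi W θ u)).sum ∧
    ∀ m n : ℕ, xi [m] θ u * xi [n] θ u = xi [m, n] θ u + xi [n, m] θ u := by
  obtain ⟨C, hC⟩ := hbd
  have hint : IntervalIntegrable u volume 0 θ := by
    rw [intervalIntegrable_iff_integrableOn_Icc_of_le hθ]
    exact Measure.integrableOn_of_bounded (by simp) hu.aestronglyMeasurable hC
  refine ⟨xi_mul_xi M N hint, fun m n => ?_⟩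
  rw [xi_mul_xi [m] [n] hint]
  simp [shuffles]
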